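/- There exists δ > 0 such that for every real v with 0 < |v| < δ, there is a unique quadruple (b0, b1, b2, b3) ∈ ℝ^4 satisfying simultaneously: N(v, b0, b1, b2, b3) = 0, (∂N/∂v)(v, b0, b1, b2, b3) = 0, (∂²N/∂v²)(v, b0, b1, b2, b3) = 0 (partial derivatives in v with b0,…,b3 held fixed), and b0 = 5 - 2·b1 - 2·b2 - 2·b3. (This quadruple gives the 8-step method with zero phase-lag and zero first and second derivatives of the phase-lag.) -/

import Mathlib

/-- Phase-lag numerator of the symmetric 8-step method. -/
noncomputable def N (v b0 b1 b2 b3 : ℝ) : ℝ :=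
  16 * Real.cos v ^ 4 + (8 * b3 * v ^ 2 - 16) * Real.cos v ^ 3
    + (4 * b2 * v ^ 2 - 8) * Real.cos v ^ 2
    + (10 + (2 * b1 - 6 * b3) * v ^ 2) * Real.cos v - 2
    + (b0 - 2 * b2) * v ^ 2

/-- First derivative of the phase-lag numerator. -/
theorem hasDerivAt_N (v b0 b1 b2 b3 : ℝ) :
    HasDerivAt (fun w => N w b0 b1 b2 b3)
      (-Real.sin v * (64 * Real.cos v ^ 3 - 48 * Real.cos v ^ 2 - 16 * Real.cos v + 10)
        + 2 * v * (8 * b3 * Real.cos v ^ 3 + 4 * b2 * Real.cos v ^ 2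
          + (2 * b1 - 6 * b3) * Real.cos v + (b0 - 2 * b2))
        - v ^ 2 * Real.sin v * (24 * b3 * Real.cos v ^ 2 + 8 * b2 * Real.cos v
          + (2 * b1 - 6 * b3))) v := by
  have hc := Real.hasDerivAt_cos v
  have hv := (hasDerivAt_id v).pow 2
  have h := (((((hc.pow 4).const_mul 16).add
    (((hv.const_mul (8 * b3)).sub_const 16).mul (hc.pow 3))).add
    (((hv.const_mul (4 * b2)).sub_const 8).mul (hc.pow 2))).add
    (((hv.const_mul (2 * b1 - 6 * b3)).const_add 10).mul hc)).sub_const 2 |>.add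
    (hv.const_mul (b0 - 2 * b2))
  refine h.congr_deriv ?_
  simp
  ring

/-- Second derivative of the phase-lag numerator. -/
theorem iteratedDeriv_two_N (v b0 b1 b2 b3 : ℝ) :
    iteratedDeriv 2 (fun w => N w b0 b1 b2 b3) v =
      -Real.cos v * (64 * Real.cos v ^ 3 - 48 * Real.cos v ^ 2 - 16 * Real.cos v + 10)
        + Real.sin v ^ 2 * (192 * Real.cos v ^ 2 - 96 * Real.cos v - 16)
        + 2 * (8 * b3 * Real.cos v ^ 3 + 4 * b2 * Real.cos v ^ 2
          + (2 * b1 - 6 * b3) * Real.cos v + (b0 - 2 * b2))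
        - 4 * v * Real.sin v * (24 * b3 * Real.cos v ^ 2 + 8 * b2 * Real.cos v
          + (2 * b1 - 6 * b3))
        + v ^ 2 * (-Real.cos v * (24 * b3 * Real.cos v ^ 2 + 8 * b2 * Real.cos v
          + (2 * b1 - 6 * b3)) + Real.sin v ^ 2 * (48 * b3 * Real.cos v + 8 * b2)) := by
  rw [iteratedDeriv_succ, iteratedDeriv_one,
    funext fun w => (hasDerivAt_N w b0 b1 b2 b3).deriv]
  have hc := Real.hasDerivAt_cos v
  have hs := Real.hasDerivAt_sin v
  have hv := hasDerivAt_id v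
  have h := ((hs.neg.mul
      (((((hc.pow 3).const_mul 64).sub ((hc.pow 2).const_mul 48)).sub
        (hc.const_mul 16)).add_const 10)).add
    ((hv.const_mul 2).mul
      (((((hc.pow 3).const_mul (8 * b3)).add ((hc.pow 2).const_mul (4 * b2))).add
        (hc.const_mul (2 * b1 - 6 * b3))).add_const (b0 - 2 * b2)))).sub
    (((hv.pow 2).mul hs).mul
      ((((hc.pow 2).const_mul (24 * b3)).add (hc.const_mul (8 * b2))).add_const
        (2 * b1 - 6 * b3)))
  refine (h.congr_deriv ?_).deriv
  simp
  ring

/-- A cubic without constant term has a unique prescribed `2`-jet at a nonzero point. -/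
theorem existsUnique_cubic_jet {x : ℝ} (hx : x ≠ 0) (p q r : ℝ) :
    ∃! a : ℝ × ℝ × ℝ,
      a.1 * x + a.2.1 * x ^ 2 + a.2.2 * x ^ 3 = p ∧
      a.1 + 2 * a.2.1 * x + 3 * a.2.2 * x ^ 2 = q ∧
      2 * a.2.1 + 6 * a.2.2 * x = r := by
  refine ⟨((6 * p - 4 * q * x + r * x ^ 2) / (2 * x),
    (-6 * p + 6 * q * x - 2 * r * x ^ 2) / (2 * x ^ 2),
    (2 * p - 2 * q * x + r * x ^ 2) / (2 * x ^ 3)), ⟨?_, ?_, ?_⟩, ?_⟩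
  · field_simp
    ring
  · field_simp
    ring
  · field_simp
    ring
  · rintro ⟨a1, a2, a3⟩ ⟨rfl, rfl, rfl⟩
    ext
    all_goals
      field_simp
      ring

/-- For all sufficiently small nonzero `v` there is a unique coefficient
quadruple with zero phase-lag, zero first and second derivatives of the
phase-lag, and the maximal-algebraic-order relation on `b0`. -/
theorem exists_unique_coeffs_zero_PL_PL'_PL'' :
    ∃ δ : ℝ, 0 < δ ∧ ∀ v : ℝ, 0 < |v| → |v| < δ →
      ∃! b : ℝ × ℝ × ℝ × ℝ,
        N v b.1 b.2.1 b.2.2.1 b.2.2.2 = 0 ∧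
        deriv (fun w => N w b.1 b.2.1 b.2.2.1 b.2.2.2) v = 0 ∧
        iteratedDeriv 2 (fun w => N w b.1 b.2.1 b.2.2.1 b.2.2.2) v = 0 ∧
        b.1 = 5 - 2 * b.2.1 - 2 * b.2.2.1 - 2 * b.2.2.2 := by
  refine ⟨Real.pi, Real.pi_pos, fun v hv0 hvπ => ?_⟩
  have hv : v ≠ 0 := abs_pos.mp hv0
  obtain ⟨hl, hr⟩ := abs_lt.mp hvπ
  have hs : Real.sin v ≠ 0 := fun h =>
    hv ((Real.sin_eq_zero_iff_of_lt_of_lt hl hr).mp h)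
  have hx : Real.cos v - 1 ≠ 0 := fun h =>
    hs (by nlinarith [Real.sin_sq_add_cos_sq v])
  have hd (b0 b1 b2 b3 : ℝ) := (hasDerivAt_N v b0 b1 b2 b3).deriv
  simp only [hd, iteratedDeriv_two_N]
  clear hd
  simp only [N]
  generalize Real.cos v = c at *
  generalize Real.sin v = s at *
  obtain ⟨p, hp⟩ : ∃ p, 16 * c ^ 4 - 16 * c ^ 3 - 8 * c ^ 2 + 10 * c - 2
      + v ^ 2 * (5 + p) = 0 :=
    ⟨-(16 * c ^ 4 - 16 * c ^ 3 - 8 * c ^ 2 + 10 * c - 2) / v ^ 2 - 5, by field_simp; ring⟩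
  obtain ⟨q, hq⟩ : ∃ q, -s * (64 * c ^ 3 - 48 * c ^ 2 - 16 * c + 10)
      + 2 * v * (5 + p) - v ^ 2 * s * q = 0 :=
    ⟨(-s * (64 * c ^ 3 - 48 * c ^ 2 - 16 * c + 10) + 2 * v * (5 + p)) / (v ^ 2 * s), by
      field_simp; ring⟩
  obtain ⟨r, hr⟩ : ∃ r, -c * (64 * c ^ 3 - 48 * c ^ 2 - 16 * c + 10)
      + s ^ 2 * (192 * c ^ 2 - 96 * c - 16) + 2 * (5 + p) - 4 * v * s * q
      + v ^ 2 * (-c * q + s ^ 2 * r) = 0 :=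
    ⟨-(-c * (64 * c ^ 3 - 48 * c ^ 2 - 16 * c + 10)
      + s ^ 2 * (192 * c ^ 2 - 96 * c - 16) + 2 * (5 + p) - 4 * v * s * q
      - v ^ 2 * c * q) / (v ^ 2 * s ^ 2), by field_simp; ring⟩
  obtain ⟨⟨a1, a2, a3⟩, ⟨h1, h2, h3⟩, huniq⟩ := existsUnique_cubic_jet hx p q r
  dsimp only at h1 h2 h3
  refine ⟨(5 - (a1 - 2 * a2 + 15 / 4 * a3) - (a2 - 3 * a3) / 2 - a3 / 4,
    (a1 - 2 * a2 + 15 / 4 * a3) / 2, (a2 - 3 * a3) / 4, a3 / 8), ⟨?_, ?_, ?_, ?_⟩, ?_⟩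
  · linear_combination hp + v ^ 2 * h1
  · linear_combination hq + 2 * v * h1 - v ^ 2 * s * h2
  · linear_combination hr + 2 * h1 - (4 * v * s + v ^ 2 * c) * h2 + v ^ 2 * s ^ 2 * h3
  · ring
  · rintro ⟨b0, b1, b2, b3⟩ ⟨e0, e1, e2, hb⟩
    dsimp only at e0 e1 e2 hb
    subst hb
    have k0 : (2 * b1 + 8 * b2 + 18 * b3) * (c - 1) + (4 * b2 + 24 * b3) * (c - 1) ^ 2
        + 8 * b3 * (c - 1) ^ 3 = p :=
      mul_left_cancel₀ (pow_ne_zero 2 hv) (by linear_combination e0 - hp)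
    have k1 : (2 * b1 + 8 * b2 + 18 * b3) + 2 * (4 * b2 + 24 * b3) * (c - 1)
        + 3 * (8 * b3) * (c - 1) ^ 2 = q :=
      mul_left_cancel₀ (mul_ne_zero (pow_ne_zero 2 hv) hs)
        (by linear_combination hq - e1 + 2 * v * k0)
    have k2 : 2 * (4 * b2 + 24 * b3) + 6 * (8 * b3) * (c - 1) = r :=
      mul_left_cancel₀ (mul_ne_zero (pow_ne_zero 2 hv) (pow_ne_zero 2 hs))
        (by linear_combination e2 - hr - 2 * k0 + (4 * v * s + v ^ 2 * c) * k1)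
    have h := huniq (2 * b1 + 8 * b2 + 18 * b3, 4 * b2 + 24 * b3, 8 * b3) ⟨k0, k1, k2⟩
    simp only [Prod.mk.injEq] at h ⊢
    obtain ⟨rfl, rfl, rfl⟩ := h
    refine ⟨?_, ?_, ?_, ?_⟩ <;> ring
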